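/- arXiv:2108.09606 — 3 statements merged into one kernel-verified Lean document; each statement's English description precedes it below -/
import Mathlib

section
/- Let α, β, v, v₀, a, P₀ be reals with 0 < α < β, 0 < v < v₀, a > 0 and P₀ ≥ 0. Let m be a natural number and let L₁, …, L_m ≥ 0 with L = Σᵢ Lᵢ ≤ a, and velocities v₁, …, v_m with vᵢ ≥ v for every i. Suppose t_final = Σᵢ Lᵢ/vᵢ + (a − L)/v₀ and P₀ + α·t_final − β·(a − L)/v₀ ≥ 0. Then L ≥ (a·β − a·α − P₀·v₀)·v / (v₀·α − v·α + v·β). -/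
/-- Lemma 1 of the paper: if the UAV reaches the destination without stop-and-recharge,
the total length `L` saved by truck rides is at least
`(aβ − aα − P₀v₀)·v / (v₀α − vα + vβ)`. -/
theorem min_saved_length
    (α β v v₀ a P₀ : ℝ)
    (hα : 0 < α) (hαβ : α < β) (hv : 0 < v) (hvv₀ : v < v₀)
    (ha : 0 < a) (hP₀ : 0 ≤ P₀)
    (m : ℕ) (Ls vs : Fin m → ℝ)
    (hLs : ∀ i, 0 ≤ Ls i) (hvs : ∀ i, v ≤ vs i)
    (L t_final : ℝ)
    (hL : L = ∑ i, Ls i) (hLa : L ≤ a)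
    (ht : t_final = (∑ i, Ls i / vs i) + (a - L) / v₀)
    (hpow : P₀ + α * t_final - β * ((a - L) / v₀) ≥ 0) :
    L ≥ (a * β - a * α - P₀ * v₀) * v / (v₀ * α - v * α + v * β) := by
  have hv₀ : 0 < v₀ := hv.trans hvv₀
  have hS : ∑ i, Ls i / vs i ≤ L / v := by
    rw [hL, Finset.sum_div]
    exact Finset.sum_le_sum fun i _ => div_le_div_of_nonneg_left (hLs i) hv (hvs i)
  have hD : 0 < v₀ * α - v * α + v * β := by nlinarith [mul_pos hα hv₀, mul_pos hv (sub_pos.2 hαβ)]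
  have h1 : 0 ≤ P₀ + α * (L / v + (a - L) / v₀) - β * ((a - L) / v₀) := by
    have := mul_le_mul_of_nonneg_left hS hα.le
    rw [ht] at hpow
    linarith
  have h2 := mul_nonneg h1 (mul_pos hv hv₀).le
  have h3 : (P₀ + α * (L / v + (a - L) / v₀) - β * ((a - L) / v₀)) * (v * v₀)
      = P₀ * v * v₀ + α * (L * v₀ + (a - L) * v) - β * (a - L) * v := by
    field_simp
  rw [h3] at h2
  rw [ge_iff_le, div_le_iff₀ hD]
  linarith
end

section
/- Let α, β, v, v₀, a, P₀ be reals with 0 < α < β, 0 < v < v₀, a > 0 and P₀ ≥ 0, and let T ≥ 0. Let m be a natural number and let L₁, …, L_m ≥ 0 with L = Σᵢ Lᵢ ≤ a, and velocities v₁, …, v_m with vᵢ ≥ v for every i. Suppose t_final = T + Σᵢ Lᵢ/vᵢ + (a − L)/v₀ and P₀ + α·t_final − β·(a − L)/v₀ ≥ 0. Then L ≥ (a·β − a·α − P₀·v₀ − v₀·T·α)·v / (v₀·α − v·α + v·β). -/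
/-- The paper's quantity `Len(T)`: if the UAV spends total stop-and-recharge time `T`,
the total length `L` saved by rides must be at least
`(aβ − aα − P₀v₀ − v₀Tα)·v / (v₀α − vα + vβ)`. -/
theorem min_saved_length_with_waiting
    (α β v v₀ a P₀ T : ℝ)
    (hα : 0 < α) (hαβ : α < β) (hv : 0 < v) (hvv₀ : v < v₀)
    (ha : 0 < a) (hP₀ : 0 ≤ P₀) (hT : 0 ≤ T)
    (m : ℕ) (Ls vs : Fin m → ℝ)
    (hLs : ∀ i, 0 ≤ Ls i) (hvs : ∀ i, v ≤ vs i)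
    (L t_final : ℝ)
    (hL : L = ∑ i, Ls i) (hLa : L ≤ a)
    (ht : t_final = T + (∑ i, Ls i / vs i) + (a - L) / v₀)
    (hpow : P₀ + α * t_final - β * ((a - L) / v₀) ≥ 0) :
    L ≥ (a * β - a * α - P₀ * v₀ - v₀ * T * α) * v / (v₀ * α - v * α + v * β) := by
  have hv₀ : 0 < v₀ := hv.trans hvv₀
  have hS : (∑ i, Ls i / vs i) ≤ L / v := by
    rw [hL, Finset.sum_div]
    exact Finset.sum_le_sum fun i _ => div_le_div_of_nonneg_left (hLs i) hv (hvs i)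
  have hD : 0 < v₀ * α - v * α + v * β := by
    nlinarith [mul_pos hv₀ hα, mul_pos hv (sub_pos.2 hαβ)]
  have h1 : 0 ≤ P₀ + α * (T + L / v + (a - L) / v₀) - β * ((a - L) / v₀) := by
    have := mul_le_mul_of_nonneg_left hS hα.le
    rw [ht] at hpow
    linarith
  have h2 := mul_nonneg h1 (mul_pos hv hv₀).le
  have h3 : (P₀ + α * (T + L / v + (a - L) / v₀) - β * ((a - L) / v₀)) * (v * v₀)
      = P₀ * v * v₀ + α * (T * v * v₀ + L * v₀ + (a - L) * v) - β * (a - L) * v := by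
    field_simp
  rw [h3] at h2
  rw [ge_iff_le, div_le_iff₀ hD]
  linarith
end

section
/- Let α, β, v, v₀, a, P₀ be reals with 0 < α < β, 0 < v < v₀, a > 0 and P₀ ≥ 0. Define Len(T) = max{(a·β − a·α − P₀·v₀ − v₀·T·α)·v / (v₀·α − v·α + v·β), 0} and D(T) = T + (a − Len(T))/v₀ + Len(T)/v. Then D is strictly increasing on [0, ∞): for all 0 ≤ T₁ < T₂, D(T₁) < D(T₂). -/
/-- The travel-time lower bound `D(T) = T + (a − Len(T))/v₀ + Len(T)/v` from
Theorem 5's competitive ratio denominator is strictly increasing on `[0, ∞)`. -/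
theorem D_strict_mono
    (α β v v₀ a P₀ : ℝ)
    (hα : 0 < α) (hαβ : α < β) (hv : 0 < v) (hvv₀ : v < v₀)
    (ha : 0 < a) (hP₀ : 0 ≤ P₀)
    (Len D : ℝ → ℝ)
    (hLen : ∀ T, Len T
      = max ((a * β - a * α - P₀ * v₀ - v₀ * T * α) * v / (v₀ * α - v * α + v * β)) 0)
    (hD : ∀ T, D T = T + (a - Len T) / v₀ + Len T / v) :
    ∀ T₁ T₂ : ℝ, 0 ≤ T₁ → T₁ < T₂ → D T₁ < D T₂ := by
  intro T₁ T₂ _ hT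
  have hv₀ : 0 < v₀ := hv.trans hvv₀
  have hvβ : 0 < v * β := mul_pos hv (hα.trans hαβ)
  have hm : 0 < (v₀ - v) * α := mul_pos (sub_pos.2 hvv₀) hα
  have hK : 0 < v₀ * α - v * α + v * β := by linarith
  have hd : 0 < T₂ - T₁ := sub_pos.2 hT
  have hc : 0 < v₀ * α * v / (v₀ * α - v * α + v * β) := by positivity
  have hL : Len T₁ ≤ Len T₂ + v₀ * α * v / (v₀ * α - v * α + v * β) * (T₂ - T₁) := by
    rw [hLen T₁, hLen T₂]
    have hx : (a * β - a * α - P₀ * v₀ - v₀ * T₁ * α) * v / (v₀ * α - v * α + v * β)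
        = (a * β - a * α - P₀ * v₀ - v₀ * T₂ * α) * v / (v₀ * α - v * α + v * β)
          + v₀ * α * v / (v₀ * α - v * α + v * β) * (T₂ - T₁) := by
      ring
    apply max_le
    · rw [hx]
      gcongr
      exact le_max_left _ _
    · exact add_nonneg (le_max_right _ _) (mul_pos hc hd).le
  have hk : 0 < 1 / v - 1 / v₀ := sub_pos.2 (one_div_lt_one_div_of_lt hv hvv₀)
  have hkc : (1 / v - 1 / v₀) * (v₀ * α * v / (v₀ * α - v * α + v * β)) < 1 := by
    have e : (1 / v - 1 / v₀) * (v₀ * α * v / (v₀ * α - v * α + v * β))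
        = ((v₀ - v) * α) / (v₀ * α - v * α + v * β) := by
      have := hK.ne'
      have := hv.ne'
      have := hv₀.ne'
      rw [mul_div_assoc', div_left_inj' hK.ne']
      field_simp
    rw [e, div_lt_one hK]
    linarith
  have h1 := mul_le_mul_of_nonneg_left hL hk.le
  have h2 := mul_lt_mul_of_pos_right hkc hd
  have e1 : ∀ T, D T = T + a / v₀ + (1 / v - 1 / v₀) * Len T := by
    intro T
    rw [hD]
    ring
  rw [e1, e1]
  linarith
end
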